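/- arXiv:2305.16771 — 5 statements merged into one kernel-verified Lean document; each statement's English description precedes it below -/
import Mathlib

section
/- Deterministic robustness of the weighted Huber minimizer under a small corruption fraction: let I be a nonempty finite index set, B ⊊ I, and let k_i ∈ [c_K, C_K] for i ∈ I with 0 < c_K ≤ C_K. Let z_i ∈ ℝ (i ∈ I) satisfy max_{i∈I} z_i − min_{i∈I} z_i ≤ Z, and let y_i ∈ ℝ satisfy y_i = z_i for all i ∈ I∖B. Let a be any minimizer over s ∈ [−M, M] of s ↦ ∑_{i∈I} k_i φ(z_i − s), and let η̂ be any minimizer over s ∈ [−M, M] of s ↦ ∑_{i∈I} k_i φ(y_i − s). Suppose n₀ > 0 satisfies |I| ≥ n₀, that T ≥ 2Z, and that |B| ≤ c_K n₀ / (3C_K + c_K). Then |η̂ − a| ≤ 2 T C_K |B| / ( c_K n₀ ). -/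
open Set
open scoped BigOperators

/-- The Huber loss with threshold `T`. -/
noncomputable def huberLoss (T u : ℝ) : ℝ := if |u| ≤ T then u ^ 2 else 2 * T * |u| - T ^ 2

/-- Half the derivative of the Huber loss: the truncation of `u` to `[-T, T]`. -/
noncomputable def huberClip (T u : ℝ) : ℝ := max (-T) (min T u)

lemma huberClip_le {T : ℝ} (hT : 0 < T) (u : ℝ) : huberClip T u ≤ T :=
  max_le (by linarith) (min_le_left _ _)

lemma neg_le_huberClip (T u : ℝ) : -T ≤ huberClip T u := le_max_left _ _

lemma huberClip_of_mem {T u : ℝ} (h₁ : -T ≤ u) (h₂ : u ≤ T) : huberClip T u = u := by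
  rw [huberClip, min_eq_right h₂, max_eq_right h₁]

lemma le_huberClip {T u t : ℝ} (htT : t ≤ T) (htu : t ≤ u) : t ≤ huberClip T u :=
  (le_min htT htu).trans (le_max_right _ _)

lemma huberClip_neg_of_neg {T u : ℝ} (hT : 0 < T) (hu : u < 0) : huberClip T u < 0 :=
  max_lt (by linarith) ((min_le_right _ _).trans_lt hu)

lemma huberClip_neg {T : ℝ} (hT : 0 < T) (u : ℝ) : huberClip T (-u) = -huberClip T u := by
  unfold huberClip
  rcases max_cases (-T) (min T (-u)) with h | h <;>
    rcases max_cases (-T) (min T u) with h' | h' <;>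
    rcases min_cases T (-u) with h'' | h'' <;>
    rcases min_cases T u with h₃ | h₃ <;> linarith

lemma huberLoss_le_sq_add (T v w : ℝ) (hT : 0 < T) :
    huberLoss T v ≤ (v - w) ^ 2 + 2 * T * |w| := by
  have hvw : |v| ≤ |v - w| + |w| := by simpa using abs_add_le (v - w) w
  rw [← sq_abs (v - w)]
  unfold huberLoss
  split_ifs with h
  · rw [← sq_abs v]
    rcases le_total |v| |w| with h' | h'
    · nlinarith [abs_nonneg v, abs_nonneg w, sq_nonneg |v - w|]
    · nlinarith [abs_nonneg v, abs_nonneg w, abs_nonneg (v - w)]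
  · nlinarith [sq_nonneg (|v - w| - T)]

lemma huberLoss_eq_clip {T : ℝ} (hT : 0 < T) (u : ℝ) :
    huberLoss T u = huberClip T u ^ 2 + 2 * T * |u - huberClip T u| := by
  unfold huberLoss
  split_ifs with h
  · rw [abs_le] at h
    simp [huberClip_of_mem h.1 h.2]
  · rw [not_le, lt_abs] at h
    rcases h with h | h
    · have hc : huberClip T u = T := by
        rw [huberClip, min_eq_left h.le, max_eq_right (by linarith)]
      rw [hc, abs_of_pos (by linarith), abs_of_pos (by linarith)]
      ring
    · have hc : huberClip T u = -T := by
        rw [huberClip, max_eq_left ((min_le_right _ _).trans (by linarith))]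
      rw [hc, abs_of_neg (by linarith), abs_of_neg (by linarith)]
      ring

lemma huberLoss_le_quadratic {T : ℝ} (hT : 0 < T) (u v : ℝ) :
    huberLoss T v ≤ huberLoss T u + 2 * huberClip T u * (v - u) + (v - u) ^ 2 := by
  have h := huberLoss_le_sq_add T v (u - huberClip T u) hT
  rw [huberLoss_eq_clip hT u]
  nlinarith

/-- First-order optimality condition for a constrained weighted Huber minimizer. -/
lemma huber_minimizer_variational {ι : Type*} {T : ℝ} (hT : 0 < T) {S : Set ℝ} (hS : Convex ℝ S)
    (I : Finset ι) (k x : ι → ℝ) (hk : ∀ i ∈ I, 0 ≤ k i) {a s : ℝ} (ha : a ∈ S) (hs : s ∈ S)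
    (hmin : ∀ r ∈ S,
      ∑ i ∈ I, k i * huberLoss T (x i - a) ≤ ∑ i ∈ I, k i * huberLoss T (x i - r)) :
    (s - a) * ∑ i ∈ I, k i * huberClip T (x i - a) ≤ 0 := by
  set C := ∑ i ∈ I, k i * huberClip T (x i - a)
  set Q := (s - a) ^ 2 * ∑ i ∈ I, k i with hQ
  have hQ0 : 0 ≤ Q := mul_nonneg (sq_nonneg _) (Finset.sum_nonneg hk)
  by_contra! hP
  set P := (s - a) * C with hPdef
  set t := P / (P + Q) with ht
  have hPQ : 0 < P + Q := by linarith
  have ht0 : 0 < t := div_pos hP hPQ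
  have ht1 : t ≤ 1 := (div_le_one hPQ).2 (by linarith)
  have hmem : a + t * (s - a) ∈ S := by
    simpa using hS.add_smul_sub_mem ha hs ⟨ht0.le, ht1⟩
  have hbound : ∑ i ∈ I, k i * huberLoss T (x i - (a + t * (s - a))) ≤
      ∑ i ∈ I, k i * huberLoss T (x i - a) - 2 * t * P + t ^ 2 * Q := by
    have hexp : ∑ i ∈ I, k i * huberLoss T (x i - a) - 2 * t * P + t ^ 2 * Q =
        ∑ i ∈ I, (k i * huberLoss T (x i - a)
          - 2 * t * (s - a) * (k i * huberClip T (x i - a)) + t ^ 2 * (s - a) ^ 2 * k i) := by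
      rw [Finset.sum_add_distrib, Finset.sum_sub_distrib, ← Finset.mul_sum, ← Finset.mul_sum,
        hPdef, hQ]
      ring
    rw [hexp]
    refine Finset.sum_le_sum fun i hi => ?_
    have h := mul_le_mul_of_nonneg_left
      (huberLoss_le_quadratic hT (x i - a) (x i - (a + t * (s - a)))) (hk i hi)
    linarith
  have h2 : t * (t * Q) ≥ t * (2 * P) := by nlinarith [hmin _ hmem]
  have h3 := le_of_mul_le_mul_left h2 ht0
  have h4 : t * (P + Q) = P := div_mul_cancel₀ _ hPQ.ne'
  nlinarith

/-- One-sided robustness bound, in terms of the first-order conditions. -/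
lemma huber_robustness_of_first_order {ι : Type*} [DecidableEq ι]
    {T Z cK CK n₀ : ℝ} (hT : 0 < T) (hcK : 0 < cK) (hcCK : cK ≤ CK) (hn₀ : 0 < n₀)
    {I B : Finset ι} (hBI : B ⊆ I) {k z y : ι → ℝ}
    (hk : ∀ i ∈ I, cK ≤ k i ∧ k i ≤ CK)
    (hspread : ∀ i ∈ I, ∀ j ∈ I, z i - z j ≤ Z)
    (hy : ∀ i ∈ I \ B, y i = z i) {a η : ℝ} (hlt : η < a)
    (ha : 0 ≤ ∑ i ∈ I, k i * huberClip T (z i - a))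
    (hη : ∑ i ∈ I, k i * huberClip T (y i - η) ≤ 0)
    (hcard : n₀ ≤ (I.card : ℝ)) (hTZ : 2 * Z ≤ T)
    (hB : (B.card : ℝ) ≤ cK * n₀ / (3 * CK + cK)) :
    a - η ≤ 2 * T * CK * B.card / (cK * n₀) := by
  have hCK : 0 < CK := hcK.trans_le hcCK
  rw [le_div_iff₀ (by linarith)] at hB
  have hb0 : (0 : ℝ) ≤ B.card := Nat.cast_nonneg _
  have hkpos : ∀ i ∈ I, 0 < k i := fun i hi => hcK.trans_le (hk i hi).1
  have hcn : 0 < cK * n₀ := mul_pos hcK hn₀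
  have hIne : I.Nonempty := by
    rw [← Finset.card_pos]
    exact_mod_cast hn₀.trans_le hcard
  have hsplit (f : ι → ℝ) : ∑ i ∈ I, f i = ∑ i ∈ I \ B, f i + ∑ i ∈ B, f i :=
    (Finset.sum_sdiff hBI).symm
  have hgood : ∑ i ∈ I \ B, k i * huberClip T (y i - η) =
      ∑ i ∈ I \ B, k i * huberClip T (z i - η) :=
    Finset.sum_congr rfl fun i hi => by rw [hy i hi]
  have hbad : -(CK * T * B.card) ≤ ∑ i ∈ B, k i * huberClip T (y i - η) := by
    have h : B.card • (-(CK * T)) ≤ ∑ i ∈ B, k i * huberClip T (y i - η) := by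
      refine Finset.card_nsmul_le_sum _ _ _ fun i hi => ?_
      nlinarith [hkpos i (hBI hi), (hk i (hBI hi)).2, neg_le_huberClip T (y i - η)]
    rw [nsmul_eq_mul] at h
    linarith
  have hbad' : ∑ i ∈ B, k i * huberClip T (z i - η) ≤ CK * T * B.card := by
    have h : ∑ i ∈ B, k i * huberClip T (z i - η) ≤ B.card • (CK * T) := by
      refine Finset.sum_le_card_nsmul _ _ _ fun i hi => ?_
      nlinarith [hkpos i (hBI hi), (hk i (hBI hi)).2, huberClip_le hT (z i - η)]
    rw [nsmul_eq_mul] at h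
    linarith
  rw [hsplit, hgood] at hη
  have hlow : ∃ j ∈ I, z j - η ≤ T / 2 := by
    by_contra! hcon
    have h : (I \ B).card • (cK * (T / 2)) ≤ ∑ i ∈ I \ B, k i * huberClip T (z i - η) := by
      refine Finset.card_nsmul_le_sum _ _ _ fun i hi => ?_
      have hiI := (Finset.mem_sdiff.1 hi).1
      exact mul_le_mul (hk i hiI).1 (le_huberClip (by linarith) (hcon i hiI).le) (by linarith)
        (hkpos i hiI).le
    rw [nsmul_eq_mul, Finset.cast_card_sdiff hBI] at h
    have h1 : T * (cK * (I.card - B.card)) ≤ T * (2 * CK * B.card) := by linarith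
    have h2 := le_of_mul_le_mul_left h1 hT
    have h3 : CK * B.card ≤ 0 := by nlinarith
    have h4 : (B.card : ℝ) = 0 := le_antisymm (nonpos_of_mul_nonpos_right h3 hCK) hb0
    rw [h4] at h2
    nlinarith
  have hhigh : ∃ j ∈ I, 0 ≤ z j - a := by
    by_contra! hcon
    exact absurd ha (not_le.2 (Finset.sum_neg (fun i hi =>
      mul_neg_of_pos_of_neg (hkpos i hi) (huberClip_neg_of_neg hT (hcon i hi))) hIne))
  obtain ⟨j, hj, hjη⟩ := hlow
  obtain ⟨l, hl, hla⟩ := hhigh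
  have hdiff : ∑ i ∈ I, k i * huberClip T (z i - η) =
      ∑ i ∈ I, k i * huberClip T (z i - a) + (∑ i ∈ I, k i) * (a - η) := by
    rw [Finset.sum_mul, ← Finset.sum_add_distrib]
    refine Finset.sum_congr rfl fun i hi => ?_
    have h1 := hspread i hi j hj
    have h2 := hspread l hl i hi
    rw [huberClip_of_mem (by linarith) (by linarith),
      huberClip_of_mem (by linarith) (by linarith)]
    ring
  have hsumk : cK * n₀ ≤ ∑ i ∈ I, k i := by
    have h := Finset.card_nsmul_le_sum I k cK fun i hi => (hk i hi).1
    rw [nsmul_eq_mul] at h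
    nlinarith
  rw [hsplit fun i => k i * huberClip T (z i - η)] at hdiff
  rw [le_div_iff₀ hcn]
  nlinarith [mul_le_mul_of_nonneg_right hsumk (sub_nonneg.2 hlt.le)]

/-- Lemma 3 of the paper: deterministic robustness of the weighted
Huber minimizer under a small corruption fraction. -/
theorem weighted_huber_minimizer_robustness_small_fraction
    {ι : Type*} [DecidableEq ι]
    (T M Z cK CK n₀ : ℝ) (hT : 0 < T) (hM : 0 < M) (hZ : 0 ≤ Z)
    (hcK : 0 < cK) (hcCK : cK ≤ CK) (hn₀ : 0 < n₀)
    (I B : Finset ι) (hI : I.Nonempty) (hBI : B ⊂ I)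
    (k z y : ι → ℝ)
    (hk : ∀ i ∈ I, cK ≤ k i ∧ k i ≤ CK)
    (hspread : ∀ i ∈ I, ∀ j ∈ I, z i - z j ≤ Z)
    (hy : ∀ i ∈ I \ B, y i = z i)
    (a etahat : ℝ)
    (ha : a ∈ Set.Icc (-M) M)
    (haMin : ∀ s ∈ Set.Icc (-M) M,
      ∑ i ∈ I, k i * huberLoss T (z i - a) ≤ ∑ i ∈ I, k i * huberLoss T (z i - s))
    (hetahat : etahat ∈ Set.Icc (-M) M)
    (hetahatMin : ∀ s ∈ Set.Icc (-M) M,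
      ∑ i ∈ I, k i * huberLoss T (y i - etahat) ≤ ∑ i ∈ I, k i * huberLoss T (y i - s))
    (hcard : n₀ ≤ (I.card : ℝ))
    (hTZ : 2 * Z ≤ T)
    (hB : (B.card : ℝ) ≤ cK * n₀ / (3 * CK + cK)) :
    |etahat - a| ≤ 2 * T * CK * B.card / (cK * n₀) := by
  have hk0 : ∀ i ∈ I, 0 ≤ k i := fun i hi => hcK.le.trans (hk i hi).1
  have hva := huber_minimizer_variational hT (convex_Icc (-M) M) I k z hk0 ha hetahat haMin
  have hvη := huber_minimizer_variational hT (convex_Icc (-M) M) I k y hk0 hetahat ha hetahatMin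
  rcases lt_trichotomy etahat a with h | h | h
  · rw [abs_of_neg (sub_neg.2 h), neg_sub]
    exact huber_robustness_of_first_order hT hcK hcCK hn₀ hBI.subset hk hspread hy h
      (nonneg_of_mul_nonpos_right hva (sub_neg.2 h))
      (nonpos_of_mul_nonpos_right hvη (sub_pos.2 h)) hcard hTZ hB
  · have hCK : 0 < CK := hcK.trans_le hcCK
    rw [h, sub_self, abs_zero]
    positivity
  · rw [abs_of_pos (sub_pos.2 h)]
    have hneg (x : ι → ℝ) (s : ℝ) : ∑ i ∈ I, k i * huberClip T (-x i - -s) =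
        -∑ i ∈ I, k i * huberClip T (x i - s) := by
      rw [← Finset.sum_neg_distrib]
      refine Finset.sum_congr rfl fun i _ => ?_
      rw [← mul_neg, ← huberClip_neg hT]
      congr 2
      ring
    have key := huber_robustness_of_first_order (z := fun i => -z i) (y := fun i => -y i)
      hT hcK hcCK hn₀ hBI.subset hk
      (fun i hi j hj => by linarith [hspread j hj i hi]) (fun i hi => by rw [hy i hi])
      (neg_lt_neg h)
      (by
        rw [hneg]
        exact neg_nonneg.2 (nonpos_of_mul_nonpos_right hva (sub_pos.2 h)))
      (by
        rw [hneg]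
        exact neg_nonpos.2 (nonneg_of_mul_nonpos_right hvη (sub_neg.2 h)))
      hcard hTZ hB
    linarith
end

section
/- Agreement of Huber and least-squares minimizers for concentrated data: let I be a nonempty finite index set, let k_i > 0 for i ∈ I, and let z_i ∈ ℝ (i ∈ I) satisfy max_{i∈I} z_i − min_{i∈I} z_i ≤ T. Then the set of minimizers over s ∈ [−M, M] of s ↦ ∑_{i∈I} k_i φ(z_i − s) coincides with the set of minimizers over s ∈ [−M, M] of s ↦ ∑_{i∈I} k_i (z_i − s)²; in particular, the Huber minimizer over [−M, M] is unique and equals the clipping to [−M, M] of the weighted mean (∑_{i∈I} k_i z_i)/(∑_{i∈I} k_i). -/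
open Set
open scoped BigOperators

theorem huberLoss_neg (T u : ℝ) : huberLoss T (-u) = huberLoss T u := by
  simp [huberLoss]

theorem huberLoss_of_abs_le {T u : ℝ} (h : |u| ≤ T) : huberLoss T u = u ^ 2 := if_pos h

theorem huberLoss_strictMonoOn {T : ℝ} (hT : 0 < T) : StrictMonoOn (huberLoss T) (Ici 0) := by
  intro v hv u hu h
  simp only [huberLoss, abs_of_nonneg (mem_Ici.1 hv), abs_of_nonneg (mem_Ici.1 hu)]
  rw [mem_Ici] at hu hv
  split_ifs <;> nlinarith

/-- On the quadratic region the Huber loss lies above its tangent lines. -/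
theorem tangent_le_huberLoss {T v : ℝ} (hv : |v| ≤ T) (u : ℝ) :
    v ^ 2 + 2 * v * (u - v) ≤ huberLoss T u := by
  obtain ⟨h₁, h₂⟩ := abs_le.1 hv
  unfold huberLoss
  split_ifs with h
  · nlinarith [sq_nonneg (u - v)]
  · rcases le_total 0 u with hu | hu
    · rw [abs_of_nonneg hu] at *
      nlinarith
    · rw [abs_of_nonpos hu] at *
      nlinarith

theorem tangent_lt_huberLoss {T u v : ℝ} (hv : |v| ≤ T) (hvT : v < T) (huv : v < u) :
    v ^ 2 + 2 * v * (u - v) < huberLoss T u := by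
  obtain ⟨h₁, h₂⟩ := abs_le.1 hv
  unfold huberLoss
  split_ifs with h
  · nlinarith [sq_pos_of_pos (sub_pos.2 huv)]
  · rcases le_total 0 u with hu | hu
    · rw [abs_of_nonneg hu] at *
      nlinarith
    · rw [abs_of_nonpos hu] at *
      nlinarith

/-- Left of the weighted mean, the Huber objective of concentrated data is strictly decreasing. -/
theorem sum_huberLoss_lt_of_lt_of_le_mean {ι : Type*} {T : ℝ} (hT : 0 < T)
    {I : Finset ι} (hI : I.Nonempty) {k z : ι → ℝ} (hk : ∀ i ∈ I, 0 < k i)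
    (hspread : ∀ i ∈ I, ∀ j ∈ I, z i - z j ≤ T) {t c : ℝ} (htc : t < c)
    (hc : ∑ i ∈ I, k i * c ≤ ∑ i ∈ I, k i * z i) :
    ∑ i ∈ I, k i * huberLoss T (z i - c) < ∑ i ∈ I, k i * huberLoss T (z i - t) := by
  by_cases hlow : ∃ i ∈ I, z i ≤ c
  · obtain ⟨i, hi, hic⟩ := hlow
    obtain ⟨j, hj, hjc⟩ := Finset.exists_le_of_sum_le hI hc
    have hcj : c ≤ z j := le_of_mul_le_mul_left hjc (hk j hj)
    have habs : ∀ l ∈ I, |z l - c| ≤ T := fun l hl =>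
      abs_le.2 ⟨by linarith [hspread j hj l hl], by linarith [hspread l hl i hi]⟩
    calc ∑ l ∈ I, k l * huberLoss T (z l - c)
        = ∑ l ∈ I, k l * (z l - c) ^ 2 :=
          Finset.sum_congr rfl fun l hl => by rw [huberLoss_of_abs_le (habs l hl)]
      _ ≤ ∑ l ∈ I, k l * ((z l - c) ^ 2 + 2 * (z l - c) * ((z l - t) - (z l - c))) := by
          have hexpand : ∑ l ∈ I, k l * ((z l - c) ^ 2 + 2 * (z l - c) * ((z l - t) - (z l - c)))
              = ∑ l ∈ I, k l * (z l - c) ^ 2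
                + 2 * (c - t) * (∑ l ∈ I, k l * z l - ∑ l ∈ I, k l * c) := by
            rw [← Finset.sum_sub_distrib, Finset.mul_sum, ← Finset.sum_add_distrib]
            exact Finset.sum_congr rfl fun l _ => by ring
          rw [hexpand]
          have := mul_nonneg (sub_pos.2 htc).le (sub_nonneg.2 hc)
          linarith
      _ < ∑ l ∈ I, k l * huberLoss T (z l - t) :=
          Finset.sum_lt_sum
            (fun l hl => mul_le_mul_of_nonneg_left (tangent_le_huberLoss (habs l hl) _) (hk l hl).le)
            ⟨i, hi, mul_lt_mul_of_pos_left
              (tangent_lt_huberLoss (habs i hi) (by linarith) (by linarith)) (hk i hi)⟩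
  · push Not at hlow
    refine Finset.sum_lt_sum_of_nonempty hI fun i hi => mul_lt_mul_of_pos_left ?_ (hk i hi)
    have := hlow i hi
    exact huberLoss_strictMonoOn hT (mem_Ici.2 (by linarith)) (mem_Ici.2 (by linarith))
      (by linarith)

/-- Right of the weighted mean, the Huber objective of concentrated data is strictly increasing. -/
theorem sum_huberLoss_lt_of_mean_le_of_lt {ι : Type*} {T : ℝ} (hT : 0 < T)
    {I : Finset ι} (hI : I.Nonempty) {k z : ι → ℝ} (hk : ∀ i ∈ I, 0 < k i)
    (hspread : ∀ i ∈ I, ∀ j ∈ I, z i - z j ≤ T) {t c : ℝ} (hct : c < t)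
    (hc : ∑ i ∈ I, k i * z i ≤ ∑ i ∈ I, k i * c) :
    ∑ i ∈ I, k i * huberLoss T (z i - c) < ∑ i ∈ I, k i * huberLoss T (z i - t) := by
  have h := sum_huberLoss_lt_of_lt_of_le_mean hT hI (z := fun i => -z i) hk
    (fun i hi j hj => by linarith [hspread j hj i hi]) (neg_lt_neg hct)
    (by simpa only [mul_neg, Finset.sum_neg_distrib, neg_le_neg_iff] using hc)
  have hneg : ∀ i s, huberLoss T (-z i - -s) = huberLoss T (z i - s) := fun i s => by
    rw [← huberLoss_neg]
    ring_nf
  simpa only [hneg] using h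

/-- The weighted least-squares objective is a parabola centred at the weighted mean. -/
theorem sum_mul_sub_sq_sub {ι : Type*} (I : Finset ι) (k z : ι → ℝ) (t c : ℝ) :
    ∑ i ∈ I, k i * (z i - t) ^ 2 - ∑ i ∈ I, k i * (z i - c) ^ 2
      = (c - t) * (2 * ∑ i ∈ I, k i * z i - (t + c) * ∑ i ∈ I, k i) := by
  rw [← Finset.sum_sub_distrib, Finset.mul_sum, Finset.mul_sum, ← Finset.sum_sub_distrib,
    Finset.mul_sum]
  exact Finset.sum_congr rfl fun i _ => by ring

/-- A function strictly decreasing up to `m` and strictly increasing from `m` on has the clipping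
of `m` as its only minimizer over an interval. -/
theorem setOf_minimizers_Icc_eq_clip {f : ℝ → ℝ} {a b m : ℝ} (hab : a ≤ b)
    (hanti : StrictAntiOn f (Iic m)) (hmono : StrictMonoOn f (Ici m)) :
    {s : ℝ | s ∈ Icc a b ∧ ∀ t ∈ Icc a b, f s ≤ f t} = {max a (min b m)} := by
  have hmem : max a (min b m) ∈ Icc a b := ⟨le_max_left _ _, max_le hab (min_le_left _ _)⟩
  have hlt : ∀ t ∈ Icc a b, t ≠ max a (min b m) → f (max a (min b m)) < f t := by
    rintro t ⟨hat, htb⟩ hne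
    rcases lt_or_gt_of_ne hne with h | h
    · have hmin : t < min b m := (lt_max_iff.1 h).resolve_left hat.not_gt
      have hle : max a (min b m) ≤ m :=
        max_le (hat.trans (hmin.le.trans (min_le_right _ _))) (min_le_right _ _)
      exact hanti (h.le.trans hle) hle h
    · have hmin : min b m < t := (le_max_right _ _).trans_lt h
      have hbm : m < t := (min_lt_iff.1 hmin).resolve_left htb.not_gt
      have hle : m ≤ max a (min b m) := le_max_of_le_right (le_min (hbm.le.trans htb) le_rfl)
      exact hmono hle (hle.trans h.le) h
  ext s
  refine ⟨fun ⟨hs, hmin⟩ => ?_, ?_⟩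
  · by_contra hne
    exact (hlt s hs hne).not_ge (hmin _ hmem)
  · rintro rfl
    refine ⟨hmem, fun t ht => ?_⟩
    rcases eq_or_ne t (max a (min b m)) with h | h
    · rw [h]
    · exact (hlt t ht h).le

/-- Lemma 4 of the paper: when the data spread is at most `T`, the
minimizers over `[-M, M]` of the weighted Huber objective coincide with those of the
weighted least-squares objective; in particular the Huber minimizer is unique and equals
the clipping to `[-M, M]` of the weighted mean. -/
theorem huber_eq_least_squares_minimizers_of_concentrated
    {ι : Type*} [DecidableEq ι]
    (T M : ℝ) (hT : 0 < T) (hM : 0 < M)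
    (I : Finset ι) (hI : I.Nonempty)
    (k z : ι → ℝ)
    (hk : ∀ i ∈ I, 0 < k i)
    (hspread : ∀ i ∈ I, ∀ j ∈ I, z i - z j ≤ T) :
    {s : ℝ | s ∈ Set.Icc (-M) M ∧ ∀ t ∈ Set.Icc (-M) M,
        ∑ i ∈ I, k i * huberLoss T (z i - s) ≤ ∑ i ∈ I, k i * huberLoss T (z i - t)}
      = {s : ℝ | s ∈ Set.Icc (-M) M ∧ ∀ t ∈ Set.Icc (-M) M,
        ∑ i ∈ I, k i * (z i - s) ^ 2 ≤ ∑ i ∈ I, k i * (z i - t) ^ 2} ∧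
    {s : ℝ | s ∈ Set.Icc (-M) M ∧ ∀ t ∈ Set.Icc (-M) M,
        ∑ i ∈ I, k i * huberLoss T (z i - s) ≤ ∑ i ∈ I, k i * huberLoss T (z i - t)}
      = {max (-M) (min M ((∑ i ∈ I, k i * z i) / (∑ i ∈ I, k i)))} := by
  have hK : 0 < ∑ i ∈ I, k i := Finset.sum_pos hk hI
  have hM' : -M ≤ M := by linarith
  have hhuber := setOf_minimizers_Icc_eq_clip (m := (∑ i ∈ I, k i * z i) / ∑ i ∈ I, k i)
    (f := fun s => ∑ i ∈ I, k i * huberLoss T (z i - s)) hM'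
    (fun t _ c hc htc => sum_huberLoss_lt_of_lt_of_le_mean hT hI hk hspread htc <| by
      rw [mem_Iic, le_div_iff₀ hK] at hc
      rwa [← Finset.sum_mul, mul_comm])
    (fun c hc t _ hct => sum_huberLoss_lt_of_mean_le_of_lt hT hI hk hspread hct <| by
      rw [mem_Ici, div_le_iff₀ hK] at hc
      rwa [← Finset.sum_mul, mul_comm])
  have hsq := setOf_minimizers_Icc_eq_clip (m := (∑ i ∈ I, k i * z i) / ∑ i ∈ I, k i)
    (f := fun s => ∑ i ∈ I, k i * (z i - s) ^ 2) hM'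
    (fun t _ c hc htc => by
      rw [mem_Iic, le_div_iff₀ hK] at hc
      rw [← sub_pos, sum_mul_sub_sq_sub]
      exact mul_pos (sub_pos.2 htc) (by nlinarith))
    (fun c hc t _ hct => by
      rw [mem_Ici, div_le_iff₀ hK] at hc
      rw [← sub_pos, sum_mul_sub_sq_sub]
      exact mul_pos_of_neg_of_neg (sub_neg.2 hct) (by nlinarith))
  exact ⟨hhuber.trans hsq.symm, hhuber⟩
end

section
/- Contamination mixing lemma: let p₁ and p₂ be probability density functions on ℝ (nonnegative, integrable, integrating to 1 with respect to Lebesgue measure) with total variation distance TV(p₁, p₂) := ∫ (p₂(u) − p₁(u)) 1{p₂(u) ≥ p₁(u)} du strictly positive, and set α := TV(p₁, p₂) / (1 + TV(p₁, p₂)). Define q₁(u) := ((1−α)/α)(p₂(u) − p₁(u)) 1{p₂(u) ≥ p₁(u)} and q₂(u) := ((1−α)/α)(p₁(u) − p₂(u)) 1{p₂(u) < p₁(u)}. Then q₁ and q₂ are probability density functions, and (1 − α) p₁(u) + α q₁(u) = (1 − α) p₂(u) + α q₂(u) for Lebesgue-almost every u ∈ ℝ. -/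
open MeasureTheory
open scoped ENNReal

/-- If `f` and `g` have the same finite integral, then the positive parts of `f - g` and `g - f`
have the same integral. -/
theorem lintegral_ofReal_sub_comm {X : Type*} [MeasurableSpace X] {μ : Measure X} {f g : X → ℝ}
    (hf : Measurable f) (hg : Measurable g) (hf0 : ∀ x, 0 ≤ f x) (hg0 : ∀ x, 0 ≤ g x)
    (hfg : ∫⁻ x, ENNReal.ofReal (f x) ∂μ = ∫⁻ x, ENNReal.ofReal (g x) ∂μ)
    (hfin : ∫⁻ x, ENNReal.ofReal (g x) ∂μ ≠ ∞) :
    ∫⁻ x, ENNReal.ofReal (f x - g x) ∂μ = ∫⁻ x, ENNReal.ofReal (g x - f x) ∂μ := by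
  have key : ∀ x, ENNReal.ofReal (g x) + ENNReal.ofReal (f x - g x) =
      ENNReal.ofReal (f x) + ENNReal.ofReal (g x - f x) := by
    intro x
    rcases le_total (f x) (g x) with h | h
    · rw [ENNReal.ofReal_of_nonpos (sub_nonpos.2 h),
        ← ENNReal.ofReal_add (hf0 x) (sub_nonneg.2 h), add_sub_cancel, add_zero]
    · rw [ENNReal.ofReal_of_nonpos (sub_nonpos.2 h),
        ← ENNReal.ofReal_add (hg0 x) (sub_nonneg.2 h), add_sub_cancel, add_zero]
  have hint := lintegral_congr (μ := μ) key
  rw [lintegral_add_left hg.ennreal_ofReal, lintegral_add_left hf.ennreal_ofReal, hfg] at hint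
  exact (ENNReal.add_right_inj hfin).1 hint

/-- Dividing the positive part of a function by its positive integral gives total mass one. -/
theorem lintegral_ofReal_inv_mul_max_zero {X : Type*} [MeasurableSpace X] {μ : Measure X}
    {f : X → ℝ} {c : ℝ} (hc : 0 < c)
    (hf : ∫⁻ x, ENNReal.ofReal (f x) ∂μ = ENNReal.ofReal c) :
    ∫⁻ x, ENNReal.ofReal (c⁻¹ * max (f x) 0) ∂μ = 1 := by
  have key : ∀ x, ENNReal.ofReal (c⁻¹ * max (f x) 0) =
      ENNReal.ofReal c⁻¹ * ENNReal.ofReal (f x) := by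
    intro x
    rw [ENNReal.ofReal_mul (inv_nonneg.2 hc.le), ENNReal.ofReal_max, ENNReal.ofReal_zero,
      max_eq_left zero_le]
  rw [lintegral_congr key, lintegral_const_mul' _ _ ENNReal.ofReal_ne_top, hf,
    ← ENNReal.ofReal_mul (inv_nonneg.2 hc.le), inv_mul_cancel₀ hc.ne', ENNReal.ofReal_one]

/-- Lemma 9 of the paper: contamination mixing lemma.  Two densities
can be contaminated, with contamination fraction `α = TV/(1+TV)`, so that the resulting
mixtures coincide. -/
theorem contamination_mixing
    (p₁ p₂ : ℝ → ℝ)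
    (hp₁meas : Measurable p₁) (hp₂meas : Measurable p₂)
    (hp₁pos : ∀ u, 0 ≤ p₁ u) (hp₂pos : ∀ u, 0 ≤ p₂ u)
    (hp₁int : ∫⁻ u, ENNReal.ofReal (p₁ u) = 1)
    (hp₂int : ∫⁻ u, ENNReal.ofReal (p₂ u) = 1)
    (tv : ℝ) (htv : tv = (∫⁻ u, ENNReal.ofReal (p₂ u - p₁ u)).toReal)
    (htvpos : 0 < tv)
    (α : ℝ) (hα : α = tv / (1 + tv))
    (q₁ q₂ : ℝ → ℝ)
    (hq₁ : ∀ u, q₁ u = (1 - α) / α * max (p₂ u - p₁ u) 0)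
    (hq₂ : ∀ u, q₂ u = (1 - α) / α * max (p₁ u - p₂ u) 0) :
    (∀ u, 0 ≤ q₁ u) ∧ (∀ u, 0 ≤ q₂ u) ∧
    (∫⁻ u, ENNReal.ofReal (q₁ u) = 1) ∧
    (∫⁻ u, ENNReal.ofReal (q₂ u) = 1) ∧
    (∀ᵐ u : ℝ, (1 - α) * p₁ u + α * q₁ u = (1 - α) * p₂ u + α * q₂ u) := by
  have hα0 : α ≠ 0 := by rw [hα]; positivity
  have hc : (1 - α) / α = tv⁻¹ := by
    rw [hα]
    field_simp
    ring
  have hA : ∫⁻ u, ENNReal.ofReal (p₂ u - p₁ u) = ENNReal.ofReal tv := by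
    rw [htv, ENNReal.ofReal_toReal]
    intro htop
    simp [htv, htop] at htvpos
  have hB : ∫⁻ u, ENNReal.ofReal (p₁ u - p₂ u) = ENNReal.ofReal tv := by
    rw [← hA]
    exact lintegral_ofReal_sub_comm hp₁meas hp₂meas hp₁pos hp₂pos (hp₁int.trans hp₂int.symm)
      (by simp [hp₂int])
  refine ⟨fun u ↦ ?_, fun u ↦ ?_, ?_, ?_, .of_forall fun u ↦ ?_⟩
  · rw [hq₁, hc]
    positivity
  · rw [hq₂, hc]
    positivity
  · simp_rw [hq₁, hc]
    exact lintegral_ofReal_inv_mul_max_zero htvpos hA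
  · simp_rw [hq₂, hc]
    exact lintegral_ofReal_inv_mul_max_zero htvpos hB
  · rw [hq₁, hq₂, ← mul_assoc, ← mul_assoc, mul_div_cancel₀ _ hα0, ← mul_add, ← mul_add]
    congr 1
    rcases le_total (p₁ u) (p₂ u) with h | h
    · rw [max_eq_left (sub_nonneg.2 h), max_eq_right (sub_nonpos.2 h)]
      ring
    · rw [max_eq_right (sub_nonpos.2 h), max_eq_left (sub_nonneg.2 h)]
      ring
end

section
/- Monotonicity of the ℓ¹ projection onto Lipschitz functions: let 𝒳 ⊆ ℝ^d be a compact set for which there exist D > 0 and α > 0 such that vol(B(x,r) ∩ 𝒳) ≥ α v_d r^d for all x ∈ 𝒳 and all 0 < r < D, let L > 0, and let 𝒢 be the class of functions g : 𝒳 → ℝ satisfying |g(x) − g(y)| ≤ L ‖x − y‖₁ for all x, y ∈ 𝒳. Let u₁, u₂ : 𝒳 → ℝ be bounded measurable functions with u₁(x) ≤ u₂(x) for all x ∈ 𝒳, and for j = 1, 2 let g_j ∈ 𝒢 be the unique minimizer of g ↦ ∫_𝒳 |u_j(x) − g(x)| dx over 𝒢 (i.e., g_j minimizes and every other L-Lipschitz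 minimizer equals g_j). Then g₁(x) ≤ g₂(x) for all x ∈ 𝒳. -/
open MeasureTheory Set
open scoped ENNReal BigOperators

/-- A function that is Lipschitz on a set with respect to the `ℓ¹` norm is continuous there. -/
lemma continuousOn_of_abs_sub_le_l1 {ι : Type*} [Fintype ι] {s : Set (EuclideanSpace ℝ ι)}
    {L : ℝ} {g : EuclideanSpace ℝ ι → ℝ}
    (hg : ∀ x ∈ s, ∀ y ∈ s, |g x - g y| ≤ L * ∑ i, |x i - y i|) : ContinuousOn g s := by
  intro y hy
  refine tendsto_iff_dist_tendsto_zero.2 ?_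
  have hlim : Filter.Tendsto (fun x : EuclideanSpace ℝ ι ↦ L * ∑ i, |x i - y i|)
      (nhdsWithin y s) (nhds 0) := by
    have hcont : Continuous fun x : EuclideanSpace ℝ ι ↦ L * ∑ i, |x i - y i| := by fun_prop
    simpa using (hcont.tendsto y).mono_left nhdsWithin_le_nhds
  refine squeeze_zero' (Filter.Eventually.of_forall fun _ ↦ dist_nonneg) ?_ hlim
  filter_upwards [self_mem_nhdsWithin] with x hx
  exact hg x hx y hy

/-- On a compact set, the difference of a bounded measurable function and a continuous function
is integrable in absolute value. -/
lemma integrableOn_abs_sub_of_bounded {E : Type*} [TopologicalSpace E] [T2Space E]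
    [MeasurableSpace E] [OpensMeasurableSpace E] {μ : Measure E} [IsFiniteMeasureOnCompacts μ]
    {s : Set E} (hs : IsCompact s) {u g : E → ℝ} (hu : Measurable u)
    (hbdd : ∃ C : ℝ, ∀ x ∈ s, |u x| ≤ C) (hg : ContinuousOn g s) :
    IntegrableOn (fun x ↦ |u x - g x|) s μ := by
  obtain ⟨C, hC⟩ := hbdd
  have hui : IntegrableOn u s μ :=
    IntegrableOn.of_bound hs.measure_lt_top hu.aestronglyMeasurable C
      ((ae_restrict_iff' hs.measurableSet).2 (Filter.Eventually.of_forall hC))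
  have hgi : IntegrableOn g s μ := by
    exact hg.integrableOn_compact' hs hs.measurableSet
  exact (hui.sub hgi).abs

/-- Exchanging two real numbers for their minimum and maximum does not increase the total distance
to an ordered pair. -/
lemma abs_sub_min_add_abs_sub_max_le {a b : ℝ} (hab : a ≤ b) (p q : ℝ) :
    |a - min p q| + |b - max p q| ≤ |a - p| + |b - q| := by
  rcases le_total p q with h | h
  · simp [h]
  · rw [min_eq_right h, max_eq_left h]
    rcases abs_cases (a - q) with h₁ | h₁ <;> rcases abs_cases (b - p) with h₂ | h₂ <;>
      rcases abs_cases (a - p) with h₃ | h₃ <;> rcases abs_cases (b - q) with h₄ | h₄ <;>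
      linarith

/-- Lemma 7 of the paper: monotonicity of the ℓ¹ projection onto the
class of functions that are `L`-Lipschitz with respect to the ℓ¹ norm, over a compact set
`𝒳` satisfying the corner shape condition. -/
theorem l1_projection_onto_lipschitz_monotone
    (d : ℕ) (hd : 0 < d)
    (𝒳 : Set (EuclideanSpace ℝ (Fin d))) (hcompact : IsCompact 𝒳)
    (D α : ℝ) (hD : 0 < D) (hα : 0 < α)
    (hcorner : ∀ x ∈ 𝒳, ∀ r : ℝ, 0 < r → r < D →
      ENNReal.ofReal
          (α * (volume (Metric.ball (0 : EuclideanSpace ℝ (Fin d)) 1)).toReal * r ^ d)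
        ≤ volume (Metric.ball x r ∩ 𝒳))
    (L : ℝ) (hL : 0 < L)
    (u₁ u₂ : EuclideanSpace ℝ (Fin d) → ℝ)
    (hu₁meas : Measurable u₁) (hu₂meas : Measurable u₂)
    (hu₁bdd : ∃ C : ℝ, ∀ x ∈ 𝒳, |u₁ x| ≤ C)
    (hu₂bdd : ∃ C : ℝ, ∀ x ∈ 𝒳, |u₂ x| ≤ C)
    (hle : ∀ x ∈ 𝒳, u₁ x ≤ u₂ x)
    (g₁ g₂ : EuclideanSpace ℝ (Fin d) → ℝ)
    (hg₁lip : ∀ x ∈ 𝒳, ∀ y ∈ 𝒳, |g₁ x - g₁ y| ≤ L * ∑ i, |x i - y i|)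
    (hg₂lip : ∀ x ∈ 𝒳, ∀ y ∈ 𝒳, |g₂ x - g₂ y| ≤ L * ∑ i, |x i - y i|)
    -- g₁ is the unique minimizer for u₁
    (hg₁min : ∀ g : EuclideanSpace ℝ (Fin d) → ℝ,
      (∀ x ∈ 𝒳, ∀ y ∈ 𝒳, |g x - g y| ≤ L * ∑ i, |x i - y i|) →
      ∫ x in 𝒳, |u₁ x - g₁ x| ≤ ∫ x in 𝒳, |u₁ x - g x|)
    (hg₁uniq : ∀ g : EuclideanSpace ℝ (Fin d) → ℝ,
      (∀ x ∈ 𝒳, ∀ y ∈ 𝒳, |g x - g y| ≤ L * ∑ i, |x i - y i|) →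
      (∀ g' : EuclideanSpace ℝ (Fin d) → ℝ,
        (∀ x ∈ 𝒳, ∀ y ∈ 𝒳, |g' x - g' y| ≤ L * ∑ i, |x i - y i|) →
        ∫ x in 𝒳, |u₁ x - g x| ≤ ∫ x in 𝒳, |u₁ x - g' x|) →
      ∀ x ∈ 𝒳, g x = g₁ x)
    -- g₂ is the unique minimizer for u₂
    (hg₂min : ∀ g : EuclideanSpace ℝ (Fin d) → ℝ,
      (∀ x ∈ 𝒳, ∀ y ∈ 𝒳, |g x - g y| ≤ L * ∑ i, |x i - y i|) →
      ∫ x in 𝒳, |u₂ x - g₂ x| ≤ ∫ x in 𝒳, |u₂ x - g x|)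
    (hg₂uniq : ∀ g : EuclideanSpace ℝ (Fin d) → ℝ,
      (∀ x ∈ 𝒳, ∀ y ∈ 𝒳, |g x - g y| ≤ L * ∑ i, |x i - y i|) →
      (∀ g' : EuclideanSpace ℝ (Fin d) → ℝ,
        (∀ x ∈ 𝒳, ∀ y ∈ 𝒳, |g' x - g' y| ≤ L * ∑ i, |x i - y i|) →
        ∫ x in 𝒳, |u₂ x - g x| ≤ ∫ x in 𝒳, |u₂ x - g' x|) →
      ∀ x ∈ 𝒳, g x = g₂ x) :
    ∀ x ∈ 𝒳, g₁ x ≤ g₂ x := by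
  have hminlip : ∀ x ∈ 𝒳, ∀ y ∈ 𝒳,
      |min (g₁ x) (g₂ x) - min (g₁ y) (g₂ y)| ≤ L * ∑ i, |x i - y i| := fun x hx y hy ↦
    (abs_min_sub_min_le_max _ _ _ _).trans (max_le (hg₁lip x hx y hy) (hg₂lip x hx y hy))
  have hmaxlip : ∀ x ∈ 𝒳, ∀ y ∈ 𝒳,
      |max (g₁ x) (g₂ x) - max (g₁ y) (g₂ y)| ≤ L * ∑ i, |x i - y i| := fun x hx y hy ↦
    (abs_max_sub_max_le_max _ _ _ _).trans (max_le (hg₁lip x hx y hy) (hg₂lip x hx y hy))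
  have hint₁ {g : EuclideanSpace ℝ (Fin d) → ℝ}
      (hg : ∀ x ∈ 𝒳, ∀ y ∈ 𝒳, |g x - g y| ≤ L * ∑ i, |x i - y i|) :
      IntegrableOn (fun x ↦ |u₁ x - g x|) 𝒳 :=
    integrableOn_abs_sub_of_bounded hcompact hu₁meas hu₁bdd (continuousOn_of_abs_sub_le_l1 hg)
  have hint₂ {g : EuclideanSpace ℝ (Fin d) → ℝ}
      (hg : ∀ x ∈ 𝒳, ∀ y ∈ 𝒳, |g x - g y| ≤ L * ∑ i, |x i - y i|) :
      IntegrableOn (fun x ↦ |u₂ x - g x|) 𝒳 :=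
    integrableOn_abs_sub_of_bounded hcompact hu₂meas hu₂bdd (continuousOn_of_abs_sub_le_l1 hg)
  have hsum : (∫ x in 𝒳, |u₁ x - min (g₁ x) (g₂ x)|) + ∫ x in 𝒳, |u₂ x - max (g₁ x) (g₂ x)| ≤
      (∫ x in 𝒳, |u₁ x - g₁ x|) + ∫ x in 𝒳, |u₂ x - g₂ x| := by
    rw [← integral_add (hint₁ hminlip) (hint₂ hmaxlip),
      ← integral_add (hint₁ hg₁lip) (hint₂ hg₂lip)]
    exact setIntegral_mono_on ((hint₁ hminlip).add (hint₂ hmaxlip))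
      ((hint₁ hg₁lip).add (hint₂ hg₂lip)) hcompact.measurableSet
      fun x hx ↦ abs_sub_min_add_abs_sub_max_le (hle x hx) _ _
  have hmax := hg₂min _ hmaxlip
  intro x hx
  refine min_eq_left_iff.1 (hg₁uniq (fun x ↦ min (g₁ x) (g₂ x)) hminlip (fun g hg ↦ ?_) x hx)
  have hmin := hg₁min g hg
  linarith
end

section
/- Interpolation inequality for Lipschitz integrable functions: let g : ℝ^d → ℝ be Lipschitz with constant L_d (with respect to the Euclidean norm) and satisfy ‖g‖₁ := ∫_{ℝ^d} |g(x)| dx < ∞. Then sup_{x ∈ ℝ^d} |g(x)| ≤ ( (d+1) L_d^d ‖g‖₁ / v_d )^{1/(d+1)}, and consequently ∫_{ℝ^d} g(x)² dx ≤ ( (d+1) L_d^d / v_d )^{1/(d+1)} · ‖g‖₁^{(d+2)/(d+1)}. -/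
open MeasureTheory Real
open scoped ENNReal

/-- The radial integral of a cone of height `M` and slope `L`. -/
lemma setIntegral_Ioi_pow_mul_cone (n : ℕ) {L M : ℝ} (hL : 0 < L) (hM : 0 ≤ M) :
    ∫ y in Set.Ioi (0 : ℝ), y ^ n * max (M - L * y) 0
      = M ^ (n + 2) / (((n : ℝ) + 1) * ((n : ℝ) + 2) * L ^ (n + 1)) := by
  have hR : 0 ≤ M / L := by positivity
  have hcone : ∀ y, y ≤ M / L → max (M - L * y) 0 = M - L * y := fun y hy ↦
    max_eq_left (by rw [le_div_iff₀ hL] at hy; linarith)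
  rw [setIntegral_eq_of_subset_of_forall_sdiff_eq_zero (s := Set.Ioc 0 (M / L))
    measurableSet_Ioi Set.Ioc_subset_Ioi_self]
  · rw [setIntegral_congr_fun (g := fun y ↦ M * y ^ n - L * y ^ (n + 1)) measurableSet_Ioc
      (fun y hy ↦ by simp only [hcone y hy.2]; ring), ← intervalIntegral.integral_of_le hR,
      intervalIntegral.integral_sub (Continuous.intervalIntegrable (by fun_prop) _ _)
        (Continuous.intervalIntegrable (by fun_prop) _ _),
      intervalIntegral.integral_const_mul, intervalIntegral.integral_const_mul,
      integral_pow, integral_pow]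
    push_cast
    simp only [div_pow, ne_eq, Nat.add_eq_zero_iff, one_ne_zero, and_false, not_false_eq_true,
      zero_pow, sub_zero]
    field_simp
    ring
  · intro y hy
    have hy' : M / L < y := by
      by_contra! h
      exact hy.2 ⟨hy.1, h⟩
    rw [div_lt_iff₀ hL] at hy'
    rw [max_eq_right (by linarith), mul_zero]

/-- The integral of a cone of height `M` and slope `L` on a finite-dimensional normed space. -/
lemma integral_cone {E : Type*} [NormedAddCommGroup E] [NormedSpace ℝ E] [FiniteDimensional ℝ E]
    [Nontrivial E] [MeasurableSpace E] [BorelSpace E] (μ : Measure E) [μ.IsAddHaarMeasure]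
    {L M : ℝ} (hL : 0 < L) (hM : 0 ≤ M) :
    ∫ x, max (M - L * ‖x‖) 0 ∂μ
      = μ.real (Metric.ball 0 1) * M ^ (Module.finrank ℝ E + 1)
        / (((Module.finrank ℝ E : ℝ) + 1) * L ^ Module.finrank ℝ E) := by
  obtain ⟨n, hn⟩ := Nat.exists_eq_succ_of_ne_zero (Module.finrank_pos (R := ℝ) (M := E)).ne'
  rw [integral_fun_norm_addHaar μ (fun r ↦ max (M - L * r) 0), hn]
  simp only [Nat.succ_eq_add_one, Nat.add_sub_cancel, smul_eq_mul, nsmul_eq_mul,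
    setIntegral_Ioi_pow_mul_cone n hL hM]
  push_cast
  field_simp
  ring

/-- A Lipschitz function dominates a cone with apex at any point of its graph. -/
lemma pow_mul_ball_le_integral_abs {E : Type*} [NormedAddCommGroup E] [NormedSpace ℝ E]
    [FiniteDimensional ℝ E] [Nontrivial E] [MeasurableSpace E] [BorelSpace E]
    (μ : Measure E) [μ.IsAddHaarMeasure] {L : ℝ} (hL : 0 < L) {g : E → ℝ}
    (hg : ∀ x y, |g x - g y| ≤ L * ‖x - y‖) (hint : Integrable g μ) (x : E) :
    μ.real (Metric.ball 0 1) * |g x| ^ (Module.finrank ℝ E + 1)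
        / (((Module.finrank ℝ E : ℝ) + 1) * L ^ Module.finrank ℝ E) ≤ ∫ y, |g y| ∂μ := by
  rw [← integral_cone μ hL (abs_nonneg _), ← integral_add_left_eq_self (fun y ↦ |g y|) x]
  refine integral_mono_of_nonneg (ae_of_all _ fun y ↦ le_max_right _ _)
    (hint.abs.comp_add_left x) (ae_of_all _ fun y ↦ max_le ?_ (abs_nonneg _))
  have h := hg x (x + y)
  rw [sub_add_cancel_left, norm_neg] at h
  linarith [abs_sub_abs_le_abs_sub (g x) (g (x + y))]

/-- Lemma 8 of the paper: interpolation inequality for Lipschitz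
integrable functions on `ℝ^d`. -/
theorem lipschitz_integrable_interpolation
    (d : ℕ) (hd : 0 < d)
    (Ld : ℝ) (hLd : 0 < Ld)
    (g : EuclideanSpace ℝ (Fin d) → ℝ)
    (hglip : ∀ x y : EuclideanSpace ℝ (Fin d), |g x - g y| ≤ Ld * ‖x - y‖)
    (hgint : Integrable g volume) :
    (∀ x : EuclideanSpace ℝ (Fin d),
      |g x| ≤ (((d : ℝ) + 1) * Ld ^ d * (∫ y, |g y|)
          / (volume (Metric.ball (0 : EuclideanSpace ℝ (Fin d)) 1)).toReal)
        ^ ((1 : ℝ) / ((d : ℝ) + 1))) ∧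
    ∫⁻ x, ENNReal.ofReal ((g x) ^ 2)
      ≤ ENNReal.ofReal
          (((((d : ℝ) + 1) * Ld ^ d
              / (volume (Metric.ball (0 : EuclideanSpace ℝ (Fin d)) 1)).toReal)
            ^ ((1 : ℝ) / ((d : ℝ) + 1)))
            * (∫ y, |g y|) ^ (((d : ℝ) + 2) / ((d : ℝ) + 1))) := by
  have : Nontrivial (EuclideanSpace ℝ (Fin d)) :=
    Module.nontrivial_of_finrank_pos (R := ℝ) (by simpa using hd)
  set v := (volume (Metric.ball (0 : EuclideanSpace ℝ (Fin d)) 1)).toReal with hv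
  have hv0 : 0 < v := ENNReal.toReal_pos (Metric.measure_ball_pos _ _ one_pos).ne'
    measure_ball_lt_top.ne
  set I := ∫ y, |g y| with hI
  have hI0 : 0 ≤ I := integral_nonneg fun y ↦ abs_nonneg _
  have hsup : ∀ x, |g x| ≤ (((d : ℝ) + 1) * Ld ^ d * I / v) ^ ((1 : ℝ) / ((d : ℝ) + 1)) := by
    intro x
    have h := pow_mul_ball_le_integral_abs volume hLd hglip hgint x
    rw [finrank_euclideanSpace_fin, div_le_iff₀ (by positivity)] at h
    rw [one_div, Real.le_rpow_inv_iff_of_pos (abs_nonneg _) (by positivity) (by positivity),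
      le_div_iff₀ hv0, ← Nat.cast_add_one, Real.rpow_natCast]
    simp only [Measure.real, ← hv, ← hI] at h
    push_cast
    linarith
  refine ⟨hsup, ?_⟩
  set B := (((d : ℝ) + 1) * Ld ^ d * I / v) ^ ((1 : ℝ) / ((d : ℝ) + 1)) with hB
  have hBI : (((d : ℝ) + 1) * Ld ^ d / v) ^ ((1 : ℝ) / ((d : ℝ) + 1))
      * I ^ (((d : ℝ) + 2) / ((d : ℝ) + 1)) = B * I := by
    have hexp : ((d : ℝ) + 2) / ((d : ℝ) + 1) = 1 / ((d : ℝ) + 1) + 1 := by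
      field_simp
      ring
    rw [hB, mul_div_right_comm _ I, Real.mul_rpow (by positivity) hI0, mul_assoc, hexp,
      Real.rpow_add_one' hI0 (by positivity)]
  rw [hBI, hI, ← integral_const_mul, ofReal_integral_eq_lintegral_ofReal
    (hgint.abs.const_mul B) (ae_of_all _ fun y ↦ by positivity)]
  refine lintegral_mono fun x ↦ ENNReal.ofReal_le_ofReal ?_
  rw [← sq_abs, sq]
  exact mul_le_mul_of_nonneg_right (hsup x) (abs_nonneg _)
end
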